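/- Let K be a field of characteristic ≠ 2 with more than three elements, G = SL₂(K), and V a quadratic ℤ[G]-module. For λ ∈ K× let t_λ = (λ 0; 0 λ⁻¹). Then for all λ, λ' ∈ K× with λ + λ' ≠ 0 and every v ∈ [U,V]: t_{λ+λ'}·v = t_λ·v + t_{λ'}·v. (In particular the map λ ↦ t_λ·v extends additively in λ on [U,V].) -/

import Mathlib

/-!
STATEMENT 7: Let K be a field of characteristic ≠ 2 with more than three elements,
G = SL₂(K), and V a quadratic ℤ[G]-module.  For λ ∈ K× let t_λ = (λ 0; 0 λ⁻¹).
Then for all λ, λ' ∈ K× with λ + λ' ≠ 0 and every v ∈ [U,V]: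
t_{λ+λ'}·v = t_λ·v + t_{λ'}·v.
-/

noncomputable section

set_option linter.unusedSimpArgs false

abbrev SL2 (K : Type*) [Field K] := Matrix.SpecialLinearGroup (Fin 2) K

/-- `u_λ = (1 λ; 0 1)`. -/
def uEl {K : Type*} [Field K] (lam : K) : SL2 K :=
  ⟨!![1, lam; 0, 1], by simp [Matrix.det_fin_two_of]⟩

/-- `t_λ = (λ 0; 0 λ⁻¹)` for `λ ≠ 0`. -/
def tEl {K : Type*} [Field K] (lam : K) (h : lam ≠ 0) : SL2 K :=
  ⟨!![lam, 0; 0, lam⁻¹], by simp [Matrix.det_fin_two_of, mul_inv_cancel₀ h]⟩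

/-- `[S,V]`, the subgroup of `V` generated by `{g·v − v : g ∈ S, v ∈ V}`. -/
def commV {K : Type*} (V : Type*) [Field K] [AddCommGroup V] [DistribMulAction (SL2 K) V]
    (S : Set (SL2 K)) : AddSubgroup V :=
  AddSubgroup.closure {w | ∃ g ∈ S, ∃ v : V, w = g • v - v}

theorem absCore {K V : Type*} [Field K] [AddCommGroup V]
    (h2 : (2 : K) ≠ 0) (a0 : K) (ha0 : a0 ≠ 0) (ha1 : a0 ^ 2 - 1 ≠ 0)
    (D t : K → V →+ V) (w i : V →+ V)
    (Dadd : ∀ a b v, D (a + b) v = D a v + D b v)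
    (DD : ∀ a b v, D a (D b v) = 0)
    (ww : ∀ v, w (w v) = i v) (ii : ∀ v, i (i v) = v)
    (iD : ∀ a v, i (D a v) = D a (i v)) (it : ∀ a, a ≠ 0 → ∀ v, i (t a v) = t a (i v))
    (iw : ∀ v, i (w v) = w (i v))
    (rel : ∀ l, l ≠ 0 → ∀ v p q r, p = v + D l v → q = w p + D l⁻¹ (w p) → r = i (w q) →
      t l (w v) = r + D l r)
    (tD : ∀ l, l ≠ 0 → ∀ m v, t l (D m v) = D (l ^ 2 * m) (t l v))
    (wt : ∀ l, l ≠ 0 → ∀ v, w (t l v) = t l⁻¹ (w v))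
    (tt : ∀ l, l ≠ 0 → ∀ v, t l (t l⁻¹ v) = v) (t1 : ∀ v, t 1 v = v) :
    ∀ m, m ≠ 0 → ∀ b x, t m (D b x) = - D m (w (D b x)) := by
  have D0 : ∀ v, D 0 v = 0 := by
    intro v
    have := Dadd 0 0 v
    simpa using this
  have S1 : ∀ l, l ≠ 0 → ∀ v, (∀ a, D a v = 0) →
      t l (w v) = v + i (w (D l⁻¹ (w v))) + D l (i (w (D l⁻¹ (w v)))) := by
    intro l hl v hv
    have := rel l hl v _ _ _ rfl rfl rfl
    simp only [hv, map_add, ww, iw, ii, add_zero, zero_add] at this ⊢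
    exact this
  have S2 : ∀ l, l ≠ 0 → ∀ v, (∀ a, D a v = 0) →
      D l (i (w (D l⁻¹ (w v)))) = t l (D l⁻¹ (w v)) := by
    intro l hl v hv
    have h := tD l hl l⁻¹ (w v)
    have e : l ^ 2 * l⁻¹ = l := by field_simp
    rw [e, S1 l hl v hv] at h
    rw [h]
    simp [hv, DD]
  have tt' : ∀ l, l ≠ 0 → ∀ v, t l⁻¹ (t l v) = v := by
    intro l hl v
    have := tt l⁻¹ (inv_ne_zero hl) v
    rwa [inv_inv] at this
  have S3 : ∀ l, l ≠ 0 → ∀ v, (∀ a, D a v = 0) →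
      i (D l⁻¹ (w v)) = - D l⁻¹ (w v) := by
    intro l hl v hv
    have h := S1 l hl v hv
    have h2 := S2 l hl v hv
    rw [h2] at h
    generalize hm : D l⁻¹ (w v) = m at *
    -- apply w
    have h3 := congrArg w h
    simp only [map_add, wt l hl, ww, iw, ii] at h3
    have h4 := congrArg (D l⁻¹) h3
    have h5 : D l⁻¹ (t l⁻¹ (i v)) = 0 := by
      have h := tD l⁻¹ (inv_ne_zero hl) l (i v)
      have e : l⁻¹ ^ 2 * l = l⁻¹ := by field_simp
      rw [e, ← iD, hv] at h
      simpa using h.symm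
    have h6 : D l⁻¹ (t l⁻¹ (w m)) = i m := by
      have h := tD l⁻¹ (inv_ne_zero hl) l (w m)
      have e : l⁻¹ ^ 2 * l = l⁻¹ := by field_simp
      rw [e] at h
      rw [← h]
      have h7 := congrArg i h2
      rw [iD, ii, it l hl] at h7
      rw [h7, tt' l hl]
    have h8 : D l⁻¹ m = 0 := by rw [← hm, DD]
    simp only [map_add, h5, h6, hm, h8] at h4
    rw [add_zero] at h4
    exact eq_neg_of_add_eq_zero_right h4.symm
  have S4 : ∀ a b v, i (D a (w (D b v))) = - D a (w (D b v)) := by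
    intro a b v
    by_cases ha : a = 0
    · subst ha; simp [D0]
    · have := S3 a⁻¹ (inv_ne_zero ha) (D b v) (fun c => DD _ _ _)
      rwa [inv_inv] at this
  have L : ∀ v, (∀ a, D a v = 0) → (∀ a, D a (w v) = 0) →
      w v = v ∧ ∀ l, l ≠ 0 → t l v = v := by
    intro v h1 h2
    have h3 : ∀ l, l ≠ 0 → t l (w v) = v := by
      intro l hl
      have := S1 l hl v h1
      simpa [h2] using this
    have h4 : w v = v := by
      have := h3 1 one_ne_zero
      rwa [t1] at this
    refine ⟨h4, fun l hl => ?_⟩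
    have := h3 l hl
    rwa [h4] at this
  have F : ∀ z, (∃ v, z = v + i v) → ∀ b, (w (D b z) = D b z ∧ ∀ l, l ≠ 0 → t l (D b z) = D b z) := by
    rintro z ⟨v, rfl⟩ b
    apply L
    · intro a; exact DD _ _ _
    · intro a
      have := S4 a b v
      simp only [map_add, ← iD, ← iw] at this ⊢
      rw [this]; simp
  have S6 : ∀ z, (∃ v, z = v + i v) → ∀ l, l ≠ 0 → ∀ c, D c (t l z) = D c (w z) := by
    intro z hz l hl c
    have hiz : i z = z := by
      obtain ⟨v, rfl⟩ := hz
      simp [ii, add_comm]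
    have hwz : ∃ v, w z = v + i v := by
      obtain ⟨v, rfl⟩ := hz
      exact ⟨w v, by simp [iw]⟩
    have f1 := (F z hz l⁻¹).1
    have f2 := (F (w z) hwz l).1
    have h := rel l hl (w z) _ _ _ rfl rfl rfl
    simp only [map_add, ww, hiz, f1, f2, iw, iD, DD] at h
    rw [h]
    simp [DD]
  have S7 : ∀ z, (∃ v, z = v + i v) → ∀ c, D c z = 0 := by
    intro z hz c
    have h1 : ∀ c, D c (t a0 z) = D c z := by
      intro c
      rw [S6 z hz a0 ha0, ← S6 z hz 1 one_ne_zero, t1]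
    have h2 : ∀ m, D m z = D (a0 ^ 2 * m) z := by
      intro m
      rw [← h1 (a0 ^ 2 * m), ← tD a0 ha0, (F z hz m).2 a0 ha0]
    have h3 := h2 (c / (a0 ^ 2 - 1))
    have e : a0 ^ 2 * (c / (a0 ^ 2 - 1)) = c / (a0 ^ 2 - 1) + c := by field_simp; ring
    rw [e, Dadd] at h3
    simpa using h3
  have S8 : ∀ b x, i (D b x) = - D b x := by
    intro b x
    have := S7 (x + i x) ⟨x, rfl⟩ b
    rw [map_add, ← iD] at this
    exact eq_neg_of_add_eq_zero_right this
  have S9 : ∀ m, m ≠ 0 → ∀ v, (∀ a, D a v = 0) → i v = - v →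
      (D m (w v) + t m v) + (D m (w v) + t m v) = 0 := by
    intro m hm v hv hi
    have hm' := inv_ne_zero hm
    have h := S1 m⁻¹ hm' v hv
    rw [S2 m⁻¹ hm' v hv, inv_inv] at h
    have hf := S8 m (w v)
    have hDf : ∀ a, D a (D m (w v)) = 0 := fun a => DD _ _ _
    generalize D m (w v) = f at *
    have h3 := congrArg w h
    simp only [map_add, wt m⁻¹ hm', ww, iw, hi, hf, map_neg, inv_inv] at h3
    have Pt : ∀ l, l ≠ 0 → ∀ y, (∀ a, D a y = 0) → ∀ a, D a (t l y) = 0 := by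
      intro l hl y hy a
      have := tD l hl (a / l ^ 2) y
      have e : l ^ 2 * (a / l ^ 2) = a := by field_simp
      rw [e, hy] at this
      simpa using this.symm
    have PE : ∀ a, D a (f + t m v) = 0 := by
      intro a; rw [map_add, hDf, Pt m hm v hv, add_zero]
    have iE : i (f + t m v) = - (f + t m v) := by
      rw [map_add, hf, it m hm, hi, map_neg, neg_add]
    have hwe : w (t m⁻¹ (f + t m v)) = - (f + t m v) := by
      rw [wt m⁻¹ hm', inv_inv, map_add, map_add, wt m hm, tt m hm, neg_add, h3]
      abel
    have hL := (L (t m⁻¹ (f + t m v)) (Pt _ hm' _ PE) (by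
      intro a; rw [hwe, map_neg, PE, neg_zero])).1
    generalize f + t m v = E at *
    have h5 := ww (t m⁻¹ E)
    rw [hL, hL, it _ hm', iE, map_neg] at h5
    have h6 := congrArg (t m) h5
    rw [map_neg, tt m hm] at h6
    nth_rewrite 1 [h6]
    simp
  intro m hm b x
  have h := S9 m hm (D (b / 2) x) (fun a => DD _ _ _) (S8 _ _)
  have e : D b x = D (b / 2) x + D (b / 2) x := by
    rw [← Dadd]; congr 2; field_simp; norm_num
  rw [e]
  simp only [map_add]
  rw [eq_neg_iff_add_eq_zero, ← h]
  abel

def wEl {K : Type*} [Field K] : SL2 K :=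
  ⟨!![0, 1; -1, 0], by simp [Matrix.det_fin_two_of]⟩

def iEl {K : Type*} [Field K] : SL2 K :=
  ⟨!![-1, 0; 0, -1], by simp [Matrix.det_fin_two_of]⟩

theorem c_mul {K : Type*} [Field K] (a b : SL2 K) : (a * b).1 = a.1 * b.1 := rfl
theorem c_one {K : Type*} [Field K] : (1 : SL2 K).1 = !![1, 0; 0, 1] := Matrix.one_fin_two
theorem c_u {K : Type*} [Field K] (a : K) : (uEl a).1 = !![1, a; 0, 1] := rfl
theorem c_t {K : Type*} [Field K] (a : K) (h : a ≠ 0) : (tEl a h).1 = !![a, 0; 0, a⁻¹] := rfl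
theorem c_w {K : Type*} [Field K] : (wEl : SL2 K).1 = !![0, 1; -1, 0] := rfl
theorem c_i {K : Type*} [Field K] : (iEl : SL2 K).1 = !![-1, 0; 0, -1] := rfl

theorem stmt7 (K V : Type*) [Field K]
    (hchar : ringChar K ≠ 2) (hcard : 3 < Cardinal.mk K)
    [AddCommGroup V] [DistribMulAction (SL2 K) V]
    (hquad : ∀ (lam mu : K) (v : V), uEl lam • (uEl mu • v - v) = uEl mu • v - v) :
    ∀ (lam lam' : K) (hlam : lam ≠ 0) (hlam' : lam' ≠ 0) (hsum : lam + lam' ≠ 0),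
      ∀ v ∈ commV V (Set.range (uEl (K := K))),
        tEl (lam + lam') hsum • v = tEl lam hlam • v + tEl lam' hlam' • v := by
  classical
  have h2 : (2 : K) ≠ 0 := Ring.two_ne_zero hchar
  obtain ⟨a0, ha0, ha1⟩ : ∃ a0 : K, a0 ≠ 0 ∧ a0 ^ 2 - 1 ≠ 0 := by
    by_contra! hcon
    have hs : (Set.univ : Set K) ⊆ (({0, 1, -1} : Finset K) : Set K) := by
      intro a _
      by_cases h : a = 0
      · simp [h]
      · have := hcon a h
        have h3 : (a - 1) * (a + 1) = 0 := by linear_combination this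
        rcases mul_eq_zero.1 h3 with h | h
        · simp [sub_eq_zero.1 h]
        · simp [eq_neg_of_add_eq_zero_left h]
    have h4 := Cardinal.mk_le_mk_of_subset hs
    rw [Cardinal.mk_univ] at h4
    have h6 := Cardinal.mk_coe_finset (s := ({0, 1, -1} : Finset K))
    have h5 : (({0, 1, -1} : Finset K).card : Cardinal) ≤ 3 := by
      exact_mod_cast Finset.card_le_three
    exact absurd hcard (not_lt.2 (h4.trans (h6.le.trans h5)))
  let A : SL2 K → V →+ V := fun g => DistribSMul.toAddMonoidHom V g
  have hA : ∀ g v, A g v = g • v := fun g v => rfl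
  let D : K → V →+ V := fun a => A (uEl a) - AddMonoidHom.id V
  have hD : ∀ a v, D a v = uEl a • v - v := fun a v => rfl
  let t : K → V →+ V := fun a => if h : a ≠ 0 then A (tEl a h) else 0
  have ht : ∀ a (h : a ≠ 0) v, t a v = tEl a h • v := by
    intro a h v; simp [t, h, hA]
  have hDD : ∀ a b v, D a (D b v) = 0 := by
    intro a b v; rw [hD, hD, hquad, sub_self]
  have huadd : ∀ a b : K, uEl (a + b) = uEl a * uEl b := by
    intro a b
    apply Subtype.ext; simp [c_mul, Matrix.one_fin_two, c_u, c_t, c_w, c_i, Matrix.mul_fin_two, add_comm]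
  have hDadd : ∀ a b v, D (a + b) v = D a v + D b v := by
    intro a b v
    have := hDD a b v
    simp only [hD, huadd, mul_smul, smul_sub] at this ⊢
    rw [← sub_eq_zero, ← this]; abel
  have gi : ∀ g : SL2 K, iEl * g = g * iEl := by
    intro g
    apply Subtype.ext; rw [c_mul, c_mul, c_i, Matrix.eta_fin_two g.1]; simp [Matrix.mul_fin_two]
  have gI : ∀ (g : SL2 K) (v : V), (iEl : SL2 K) • g • v = g • (iEl : SL2 K) • v := by
    intro g v; rw [smul_smul, gi, mul_smul]
  have key := absCore h2 a0 ha0 ha1 D t (A wEl) (A iEl) hDadd hDD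
    (by
      intro v; simp only [hA, smul_smul]; congr 1
      apply Subtype.ext; simp [c_mul, Matrix.one_fin_two, c_u, c_t, c_w, c_i, Matrix.mul_fin_two])
    (by
      intro v; simp only [hA, smul_smul]
      have : (iEl * iEl : SL2 K) = 1 := by
        apply Subtype.ext; simp [c_mul, Matrix.one_fin_two, c_u, c_t, c_w, c_i, Matrix.mul_fin_two]
      rw [this, one_smul])
    (by intro a v; simp only [hA, hD, smul_sub, gI])
    (by intro a ha v; simp only [hA, ht a ha, gI])
    (by intro v; simp only [hA, gI])
    (by
      intro l hl v p q r hp hq hr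
      have hp' : p = uEl l • v := by rw [hp, hD]; abel
      have hq' : q = uEl l⁻¹ • (wEl : SL2 K) • p := by rw [hq, hD, hA]; abel
      rw [hD, ht l hl, add_sub_cancel, hr, hq', hp']
      simp only [hA, smul_smul]; congr 1
      apply Subtype.ext; simp [c_mul, Matrix.one_fin_two, c_u, c_t, c_w, c_i, Matrix.mul_fin_two, hl])
    (by
      intro l hl m v
      simp only [ht l hl, hD, smul_sub, smul_smul]; congr 2
      apply Subtype.ext; simp [c_mul, Matrix.one_fin_two, c_u, c_t, c_w, c_i, Matrix.mul_fin_two]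
      field_simp)
    (by
      intro l hl v
      simp only [ht l hl, ht l⁻¹ (inv_ne_zero hl), hA, smul_smul]; congr 1
      apply Subtype.ext; simp [c_mul, Matrix.one_fin_two, c_u, c_t, c_w, c_i, Matrix.mul_fin_two])
    (by
      intro l hl v
      simp only [ht l hl, ht l⁻¹ (inv_ne_zero hl), smul_smul]
      have : tEl l hl * tEl l⁻¹ (inv_ne_zero hl) = 1 := by
        apply Subtype.ext; simp [c_mul, Matrix.one_fin_two, c_u, c_t, c_w, c_i, Matrix.mul_fin_two, hl]
      rw [this, one_smul])
    (by
      intro v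
      rw [ht 1 one_ne_zero]
      have : tEl (1 : K) one_ne_zero = 1 := by
        apply Subtype.ext; simp [c_mul, Matrix.one_fin_two, c_u, c_t, c_w, c_i, Matrix.mul_fin_two]
      rw [this, one_smul])
  intro l l' hl hl' hs v hv
  induction hv using AddSubgroup.closure_induction with
  | mem x hx =>
    obtain ⟨_, ⟨b, rfl⟩, y, rfl⟩ := hx
    rw [← hD, ← ht, ← ht, ← ht, key _ hs, key _ hl, key _ hl', hDadd]
    abel
  | zero => simp
  | add x y _ _ hx hy => rw [smul_add, smul_add, smul_add, hx, hy]; abel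
  | neg x _ hx => rw [smul_neg, smul_neg, smul_neg, hx]; abel
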